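/- arXiv:2412.09061 — 2 statements merged into one kernel-verified Lean document; each statement's English description precedes it below -/
import Mathlib

section
/- Let n ≥ 1, Ψ : ℝⁿ → [0,∞), h ∈ ℝ, m ≠ 0, and let φ₀ : ℝ → ℝ be a smooth function with support contained in [1/4, 1]. Let Φ : ℝ × (ℝ∖{0}) × ℝⁿ → ℂ be smooth in its first variable and suppose there is C₁ > 0 such that |∂_s^k [Φ(2^N s, m, z)]| ≤ C₁ for k = 0, 1, for all (s, m, z) ∈ [1/4, 1] × (ℝ∖{0}) × ℝⁿ and all N ∈ ℤ. For t ≠ 0, z ∈ ℝⁿ and N ∈ ℤ define 𝒦_N^±(m,t,z) = ∫₀^∞ e^{−i t √(2^{4N} s⁴ + m²)} e^{± i 2^N s Ψ(z)} s^h φ₀(s) Φ(2^N s, m, z) ds. Fix N′ ∈ ℤ. Then there exists C > 0, depending only on C₁, φ₀, h and N′, such that for every N ≤ N′, every m ≠ 0, every t ≠ 0 and every z ∈ ℝⁿ: |𝒦_N^±(m,t,z)| ≤ C ⟨m⟩^{1/2} (1 + |t| 2^{4N})^{−1/2}. -/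
open MeasureTheory

/-- The van der Corput second derivative test for an amplitude vanishing at the endpoints. -/
theorem norm_integral_exp_mul_le_of_le_deriv_deriv {a b : ℝ} (hab : a ≤ b)
    {g g' g'' : ℝ → ℝ} {A A' : ℝ → ℂ} {M μ σ : ℝ}
    (hg : ∀ s ∈ Set.Icc a b, HasDerivAt g (g' s) s)
    (hg' : ∀ s ∈ Set.Icc a b, HasDerivAt g' (g'' s) s)
    (hA : ∀ s ∈ Set.Icc a b, HasDerivAt A (A' s) s)
    (hAa : A a = 0) (hAb : A b = 0)
    (hM : ∀ s ∈ Set.Icc a b, ‖A s‖ ≤ M) (hM' : ∀ s ∈ Set.Icc a b, ‖A' s‖ ≤ M)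
    (hμ : 0 < μ) (hσ : |σ| = 1) (hμg : ∀ s ∈ Set.Icc a b, μ ≤ σ * g'' s) :
    ‖∫ s in a..b, Complex.exp (Complex.I * (g s : ℂ)) * A s‖
      ≤ M * (2 * Real.pi + (b - a) / 2) / √μ := by
  set κ := √μ
  have hκ : 0 < κ := Real.sqrt_pos.2 hμ
  have hκμ : κ ^ 2 = μ := Real.sq_sqrt hμ.le
  have hM0 : 0 ≤ M := (norm_nonneg _).trans (hM a ⟨le_rfl, hab⟩)
  set u : ℝ → ℂ := fun s => Complex.exp (Complex.I * (g s : ℂ)) * A s with hu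
  have hE : ∀ s ∈ Set.Icc a b, HasDerivAt (fun s => Complex.exp (Complex.I * (g s : ℂ)))
      (Complex.exp (Complex.I * (g s : ℂ)) * (Complex.I * (g' s : ℂ))) s := fun s hs =>
    ((hg s hs).ofReal_comp.const_mul Complex.I).cexp
  have huc : ContinuousOn u (Set.Icc a b) := fun s hs =>
    ((hE s hs).mul (hA s hs)).continuousAt.continuousWithinAt
  -- a bounded substitute for the reciprocal of the phase derivative
  set w : ℝ → ℝ := fun s => g' s / (g' s ^ 2 + κ ^ 2) with hw
  set w' : ℝ → ℝ := fun s => g'' s * (κ ^ 2 - g' s ^ 2) / (g' s ^ 2 + κ ^ 2) ^ 2 with hw'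
  have hD : ∀ s, 0 < g' s ^ 2 + κ ^ 2 := fun s => by positivity
  have hwd : ∀ s ∈ Set.Icc a b, HasDerivAt w (w' s) s := fun s hs => by
    refine ((hg' s hs).div (((hg' s hs).pow 2).add_const _) (hD s).ne').congr_deriv ?_
    simp only [hw']
    congr 1
    simp only [Pi.pow_apply]
    push_cast
    ring
  set F : ℝ → ℂ := fun s => u s * (w s : ℂ) with hF
  set F' : ℝ → ℂ := fun s => (Complex.exp (Complex.I * (g s : ℂ)) * (Complex.I * (g' s : ℂ)) * A s
      + Complex.exp (Complex.I * (g s : ℂ)) * A' s) * (w s : ℂ) + u s * (w' s : ℂ) with hF'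
  have hFd : ∀ s ∈ Set.Icc a b, HasDerivAt F (F' s) s := fun s hs =>
    ((hE s hs).mul (hA s hs)).mul (hwd s hs).ofReal_comp
  have hint : ∀ x ∈ Set.Icc a b, IntervalIntegrable u volume a x := fun x hx =>
    (huc.mono (Set.Icc_subset_Icc_right hx.2)).intervalIntegrable_of_Icc hx.1
  set H : ℝ → ℂ := fun x => (∫ s in a..x, u s) + Complex.I * F x with hH
  have hHc : ContinuousOn H (Set.Icc a b) := by
    refine ContinuousOn.add ?_ (continuousOn_const.mul
      fun s hs => (hFd s hs).continuousAt.continuousWithinAt)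
    have := intervalIntegral.continuousOn_primitive_interval (μ := volume) (f := u)
      (a := a) (b := b) (by rw [Set.uIcc_of_le hab]; exact huc.integrableOn_Icc)
    rwa [Set.uIcc_of_le hab] at this
  have hHd : ∀ x ∈ Set.Ico a b,
      HasDerivWithinAt H (u x + Complex.I * F' x) (Set.Ici x) x := fun x hx => by
    have hx' := Set.Ico_subset_Icc_self hx
    refine HasDerivWithinAt.add ?_ ((hFd x hx').const_mul _).hasDerivWithinAt
    refine intervalIntegral.integral_hasDerivWithinAt_right (t := Set.Ioi x) (hint x hx') ?_ ?_
    · refine (huc.stronglyMeasurableAtFilter_nhdsWithin measurableSet_Icc x).filter_mono ?_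
      exact nhdsWithin_le_of_mem (Filter.mem_of_superset (Ioo_mem_nhdsGT hx.2)
        fun y hy => ⟨hx.1.trans hy.1.le, hy.2.le⟩)
    · exact ((hE x hx').mul (hA x hx')).continuousAt.continuousWithinAt
  set B : ℝ → ℝ := fun s =>
    M * (2 * σ * (Real.arctan (g' s / κ) - Real.arctan (g' a / κ)) + (s - a) / 2) / κ with hB
  set B' : ℝ → ℝ := fun s =>
    M * (2 * σ * (1 / (1 + (g' s / κ) ^ 2) * (g'' s / κ)) + 1 / 2) / κ with hB'
  have hBd : ∀ s ∈ Set.Icc a b, HasDerivAt B (B' s) s := fun s hs =>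
    ((((((hg' s hs).div_const κ).arctan.sub_const _).const_mul (2 * σ)).add
      (((hasDerivAt_id s).sub_const a).div_const 2)).const_mul M).div_const κ
  have hbound : ∀ s ∈ Set.Icc a b, ‖u s + Complex.I * F' s‖ ≤ B' s := fun s hs => by
    set d := g' s ^ 2 + κ ^ 2 with hd
    have hd0 : 0 < d := hD s
    have hdC : ((g' s : ℂ) ^ 2 + (κ : ℂ) ^ 2) ≠ 0 := by exact_mod_cast hd0.ne'
    have habs : |g'' s| = σ * g'' s := by
      rw [← abs_of_pos (hμ.trans_le (hμg s hs)), abs_mul, hσ, one_mul]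
    have key : u s + Complex.I * F' s = Complex.exp (Complex.I * (g s : ℂ)) *
        (A s * ((κ ^ 2 / d : ℝ) : ℂ) + Complex.I * (A' s * (w s : ℂ))
          + Complex.I * (A s * (w' s : ℂ))) := by
      have : ((κ ^ 2 / d : ℝ) : ℂ) = 1 - (g' s : ℂ) * (w s : ℂ) := by
        simp only [hw, hd]; push_cast; field_simp; ring
      rw [this]
      simp only [hF', hu]
      linear_combination (Complex.exp (Complex.I * (g s : ℂ)) * A s * (g' s : ℂ) * (w s : ℂ))
        * Complex.I_sq
    have hw1 : |w s| ≤ 1 / (2 * κ) := by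
      simp only [hw]
      rw [abs_div, abs_of_pos hd0, div_le_div_iff₀ hd0 (by positivity), hd]
      nlinarith [sq_nonneg (|g' s| - κ), sq_abs (g' s)]
    have hw2 : |w' s| ≤ σ * g'' s / d := by
      simp only [hw']
      rw [abs_div, abs_mul, habs, abs_of_pos (pow_pos hd0 2), sq d, ← div_div]
      have h1 : |κ ^ 2 - g' s ^ 2| ≤ d := by
        rw [abs_le]; constructor <;> nlinarith [sq_nonneg κ, sq_nonneg (g' s)]
      have h0 : 0 ≤ σ * g'' s := hμ.le.trans (hμg s hs)
      gcongr
      rw [div_le_iff₀ hd0]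
      gcongr
    have hw3 : |κ ^ 2 / d| ≤ σ * g'' s / d := by
      rw [abs_of_nonneg (by positivity), hκμ]
      gcongr
      exact hμg s hs
    have hBeq : B' s = M * (σ * g'' s / d) + M * (1 / (2 * κ)) + M * (σ * g'' s / d) := by
      simp only [hB', hd]
      have := (hD s).ne'
      have h2 : 1 + (g' s / κ) ^ 2 ≠ 0 := by positivity
      rw [show 1 / (1 + (g' s / κ) ^ 2) = κ ^ 2 / (g' s ^ 2 + κ ^ 2) by field_simp; ring]
      field_simp
      ring
    have hexp : ‖Complex.exp (Complex.I * (g s : ℂ))‖ = 1 := by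
      rw [mul_comm]; exact Complex.norm_exp_ofReal_mul_I _
    rw [key, norm_mul, hexp, one_mul, hBeq]
    refine (norm_add₃_le).trans ?_
    simp only [norm_mul, Complex.norm_I, one_mul, Complex.norm_real, Real.norm_eq_abs]
    have := hM s hs
    have := hM' s hs
    gcongr
  have hfin := image_norm_le_of_norm_deriv_right_le_deriv_boundary' hHc hHd
    (B := B) (B' := B') (by simp [hH, hB, hF, hu, hAa])
    (fun s hs => (hBd s hs).continuousAt.continuousWithinAt)
    (fun s hs => (hBd s (Set.Ico_subset_Icc_self hs)).hasDerivWithinAt)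
    (fun s hs => hbound s (Set.Ico_subset_Icc_self hs)) (Set.right_mem_Icc.2 hab)
  have hHb : H b = ∫ s in a..b, u s := by simp [hH, hF, hu, hAb]
  rw [hHb] at hfin
  refine hfin.trans ?_
  have harc : σ * (Real.arctan (g' b / κ) - Real.arctan (g' a / κ)) ≤ Real.pi := by
    refine (le_abs_self _).trans ?_
    rw [abs_mul, hσ, one_mul, abs_le]
    constructor <;> linarith [Real.arctan_lt_pi_div_two (g' b / κ),
      Real.neg_pi_div_two_lt_arctan (g' b / κ), Real.arctan_lt_pi_div_two (g' a / κ),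
      Real.neg_pi_div_two_lt_arctan (g' a / κ)]
  simp only [hB, mul_assoc]
  gcongr

theorem hasDerivAt_sqrt_quartic {l m : ℝ} (hl : 0 < l) {s : ℝ} (hs : 0 < s) :
    HasDerivAt (fun s => √(l * s ^ 4 + m ^ 2)) (2 * l * s ^ 3 / √(l * s ^ 4 + m ^ 2)) s := by
  have hpos : 0 < l * s ^ 4 + m ^ 2 := by positivity
  refine ((((hasDerivAt_id s).pow 4).const_mul l).add_const (m ^ 2)).sqrt
    (by simpa using hpos.ne') |>.congr_deriv ?_
  simp only [id, Pi.pow_apply]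
  field_simp
  norm_num

theorem hasDerivAt_deriv_sqrt_quartic {l m : ℝ} (hl : 0 < l) {s : ℝ} (hs : 0 < s) :
    HasDerivAt (fun s => 2 * l * s ^ 3 / √(l * s ^ 4 + m ^ 2))
      (l * s ^ 2 * (2 * l * s ^ 4 + 6 * m ^ 2) / √(l * s ^ 4 + m ^ 2) ^ 3) s := by
  have hpos : 0 < l * s ^ 4 + m ^ 2 := by positivity
  have hr : 0 < √(l * s ^ 4 + m ^ 2) := Real.sqrt_pos.2 hpos
  have hsq : √(l * s ^ 4 + m ^ 2) ^ 2 = l * s ^ 4 + m ^ 2 := Real.sq_sqrt hpos.le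
  refine ((((hasDerivAt_id s).pow 3).const_mul (2 * l)).div
    (hasDerivAt_sqrt_quartic (m := m) hl hs) hr.ne').congr_deriv ?_
  simp only [id, Pi.pow_apply]
  generalize √(l * s ^ 4 + m ^ 2) = r at hr hsq ⊢
  field_simp
  norm_num
  linear_combination 6 * s ^ 2 * hsq

/-- Uniform convexity of the dispersion relation `√(l s⁴ + m²)` on `[1/4, 1]`. -/
theorem le_deriv_deriv_sqrt_quartic {l m R : ℝ} (hl : 0 < l) {s : ℝ}
    (hs : s ∈ Set.Icc (1 / 4 : ℝ) 1) (hR : √l + |m| ≤ R) :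
    l / (8 * R) ≤ l * s ^ 2 * (2 * l * s ^ 4 + 6 * m ^ 2) / √(l * s ^ 4 + m ^ 2) ^ 3 := by
  have hs0 : 0 < s := by linarith [hs.1]
  have hpos : 0 < l * s ^ 4 + m ^ 2 := by positivity
  have hr : 0 < √(l * s ^ 4 + m ^ 2) := Real.sqrt_pos.2 hpos
  have hsq : √(l * s ^ 4 + m ^ 2) ^ 2 = l * s ^ 4 + m ^ 2 := Real.sq_sqrt hpos.le
  have hrR : √(l * s ^ 4 + m ^ 2) ≤ R := by
    refine le_trans (Real.sqrt_le_iff.2 ⟨by positivity, ?_⟩) hR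
    have h1 : s ^ 4 ≤ 1 := pow_le_one₀ hs0.le hs.2
    nlinarith [Real.sq_sqrt hl.le, sq_abs m, mul_nonneg (Real.sqrt_nonneg l) (abs_nonneg m)]
  generalize √(l * s ^ 4 + m ^ 2) = r at hr hsq hrR ⊢
  have hs2 : (1 / 16 : ℝ) ≤ s ^ 2 := by nlinarith [hs.1]
  calc l / (8 * R) ≤ l / (8 * r) := by gcongr
    _ = l * (1 / 16) * (2 * r ^ 2) / r ^ 3 := by field_simp; norm_num
    _ ≤ _ := by
      rw [hsq]
      have : 0 ≤ m ^ 2 := sq_nonneg m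
      gcongr ?_ / _
      gcongr
      linarith

/-- `φ` times a power is bounded together with its derivative on `[1/4, 1]`. -/
theorem exists_bound_rpow_mul {φ : ℝ → ℝ} (hφ : ContDiff ℝ (⊤ : ℕ∞) φ) (h : ℝ) :
    ∃ K > 0, ∃ a' : ℝ → ℝ, ∀ s ∈ Set.Icc (1 / 4 : ℝ) 1,
      HasDerivAt (fun s => s ^ h * φ s) (a' s) s ∧ |s ^ h * φ s| ≤ K ∧ |a' s| ≤ K := by
  have hφc : Continuous φ := hφ.continuous
  have hφ'c : Continuous (deriv φ) := hφ.continuous_deriv (by simp)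
  have hpow : ∀ p : ℝ, ContinuousOn (fun s : ℝ => s ^ p) (Set.Icc (1 / 4 : ℝ) 1) := fun p =>
    continuousOn_id.rpow_const fun s hs => Or.inl (by simp only [id]; linarith [hs.1])
  obtain ⟨K₀, hK₀⟩ := isCompact_Icc.exists_bound_of_continuousOn
    ((hpow h).mul hφc.continuousOn)
  obtain ⟨K₁, hK₁⟩ := isCompact_Icc.exists_bound_of_continuousOn
    (((continuousOn_const (c := h)).mul (hpow (h - 1))).mul hφc.continuousOn |>.add
      ((hpow h).mul hφ'c.continuousOn))
  refine ⟨max 1 (max K₀ K₁), by positivity, fun s => h * s ^ (h - 1) * φ s + s ^ h * deriv φ s,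
    fun s hs => ⟨?_, ?_, ?_⟩⟩
  · exact (Real.hasDerivAt_rpow_const (Or.inl (by linarith [hs.1]))).mul
      ((hφ.differentiable (by simp)) s).hasDerivAt
  · exact (hK₀ s hs).trans ((le_max_left _ _).trans (le_max_right _ _))
  · exact (hK₁ s hs).trans ((le_max_right _ _).trans (le_max_right _ _))

/-- A trivial bound and a decay bound `x ^ (-1/2)` combine into decay in `1 + x`. -/
theorem le_mul_one_add_rpow_neg_half {v Q x : ℝ} (hx : 0 < x) (hQ : 0 ≤ Q)
    (h₁ : v ≤ Q) (h₂ : v ≤ Q / √x) : v ≤ √2 * Q * (1 + x) ^ (-(1 / 2) : ℝ) := by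
  rw [Real.rpow_neg (by positivity), ← Real.sqrt_eq_rpow, ← div_eq_mul_inv,
    le_div_iff₀ (by positivity)]
  rcases le_total x 1 with hx1 | hx1
  · calc v * √(1 + x) ≤ Q * √2 := by gcongr; linarith
      _ = _ := mul_comm _ _
  · calc v * √(1 + x) ≤ Q / √x * √(2 * x) := by gcongr; linarith
      _ = _ := by
        rw [Real.sqrt_mul (by norm_num)]
        field_simp

/-- Oscillatory integral estimate, low-frequency case `N ≤ N′` with mass `m ≠ 0`
(Lemma 2.1 (iii)). Here `⟨m⟩ = 1 + |m|`. -/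
theorem stmt_2 (n : ℕ) (hn : 1 ≤ n)
    (Ψ : (Fin n → ℝ) → ℝ) (hΨ : ∀ z, 0 ≤ Ψ z)
    (h : ℝ)
    (φ₀ : ℝ → ℝ) (hφ₀ : ContDiff ℝ (⊤ : ℕ∞) φ₀)
    (hφ₀supp : Function.support φ₀ ⊆ Set.Icc (1/4 : ℝ) 1)
    (Φ : ℝ → ℝ → (Fin n → ℝ) → ℂ)
    (hΦ : ∀ m : ℝ, m ≠ 0 → ∀ z, ContDiff ℝ (⊤ : ℕ∞) (fun s => Φ s m z))
    (C₁ : ℝ) (hC₁ : 0 < C₁)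
    (hΦbound : ∀ k : ℕ, k ≤ 1 → ∀ N : ℤ, ∀ s : ℝ, s ∈ Set.Icc (1/4 : ℝ) 1 →
      ∀ m : ℝ, m ≠ 0 → ∀ z,
      ‖iteratedDeriv k (fun s' => Φ ((2:ℝ)^N * s') m z) s‖ ≤ C₁)
    (N' : ℤ) :
    ∃ C > 0, ∀ N : ℤ, N ≤ N' → ∀ m : ℝ, m ≠ 0 → ∀ ε : ℝ, (ε = 1 ∨ ε = -1) →
      ∀ t : ℝ, t ≠ 0 → ∀ z : Fin n → ℝ,
      ‖∫ s in Set.Ioi (0:ℝ),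
          Complex.exp (-(Complex.I *
            ((t * Real.sqrt ((2:ℝ)^(4*N) * s^4 + m^2) : ℝ) : ℂ)))
          * Complex.exp ((ε : ℂ) * Complex.I * (((2:ℝ)^N * s * Ψ z : ℝ) : ℂ))
          * ((s ^ h : ℝ) : ℂ) * ((φ₀ s : ℝ) : ℂ) * Φ ((2:ℝ)^N * s) m z‖
        ≤ C * (1 + |m|) ^ ((1:ℝ)/2) * (1 + |t| * (2:ℝ)^(4*N)) ^ (-(1/2) : ℝ) := by
  obtain ⟨K, hK, a', ha⟩ := exists_bound_rpow_mul hφ₀ h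
  set L : ℝ := 1 + (2 : ℝ) ^ (2 * N') with hL
  have hL1 : 1 ≤ L := by rw [hL]; linarith [zpow_pos (two_pos : (0 : ℝ) < 2) (2 * N')]
  set M : ℝ := 2 * K * C₁ with hM
  have hM0 : 0 < M := by positivity
  set D : ℝ := (2 * Real.pi + (1 - 1 / 4) / 2) * √(8 * L) with hD
  have hD1 : 1 ≤ D := by
    have : 1 ≤ √(8 * L) := Real.one_le_sqrt.2 (by linarith)
    nlinarith [Real.pi_gt_three]
  refine ⟨√2 * (M * D), by positivity, fun N hN m hm ε hε t ht z => ?_⟩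
  set l : ℝ := (2 : ℝ) ^ (4 * N) with hl
  have hl0 : 0 < l := by positivity
  set A : ℝ → ℂ := fun s => ((s ^ h * φ₀ s : ℝ) : ℂ) * Φ ((2 : ℝ) ^ N * s) m z with hA
  set g : ℝ → ℝ := fun s => -t * √(l * s ^ 4 + m ^ 2) + ε * (2 : ℝ) ^ N * Ψ z * s with hg
  have hφ0 : ∀ s, s ∉ Set.Ioo (1 / 4 : ℝ) 1 → φ₀ s = 0 := by
    have hsupp : Function.support φ₀ ⊆ Set.Ioo (1 / 4 : ℝ) 1 := by
      rw [← interior_Icc]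
      exact (hφ₀.continuous.isOpen_support).subset_interior_iff.2 hφ₀supp
    exact fun s hs => Function.notMem_support.1 fun h' => hs (hsupp h')
  have hintegral : (∫ s in Set.Ioi (0 : ℝ),
      Complex.exp (-(Complex.I * ((t * √(l * s ^ 4 + m ^ 2) : ℝ) : ℂ)))
        * Complex.exp ((ε : ℂ) * Complex.I * (((2 : ℝ) ^ N * s * Ψ z : ℝ) : ℂ))
        * ((s ^ h : ℝ) : ℂ) * ((φ₀ s : ℝ) : ℂ) * Φ ((2 : ℝ) ^ N * s) m z)
      = ∫ s in (1 / 4 : ℝ)..1, Complex.exp (Complex.I * (g s : ℂ)) * A s := by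
    rw [intervalIntegral.integral_of_le (by norm_num),
      ← setIntegral_eq_of_subset_of_forall_sdiff_eq_zero (s := Set.Ioc (1 / 4 : ℝ) 1)
        (t := Set.Ioi 0) measurableSet_Ioi (fun s hs => lt_trans (by norm_num) hs.1)]
    · refine setIntegral_congr_fun measurableSet_Ioi fun s _ => ?_
      simp only [hA, hg]
      rw [← Complex.exp_add]
      push_cast
      ring_nf
    · intro s hs
      simp [hA, hφ0 s fun h' => hs.2 (Set.Ioo_subset_Ioc_self h')]
  rw [hintegral]
  have hΦd : ∀ s, HasDerivAt (fun s' => Φ ((2 : ℝ) ^ N * s') m z)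
      (deriv (fun s' => Φ ((2 : ℝ) ^ N * s') m z) s) s := fun s =>
    ((((hΦ m hm z).differentiable (by simp)).comp
      (differentiable_id.const_mul ((2 : ℝ) ^ N))) s).hasDerivAt
  have hΦ0 : ∀ s ∈ Set.Icc (1 / 4 : ℝ) 1, ‖Φ ((2 : ℝ) ^ N * s) m z‖ ≤ C₁ := fun s hs => by
    simpa using hΦbound 0 (by norm_num) N s hs m hm z
  have hΦ1 : ∀ s ∈ Set.Icc (1 / 4 : ℝ) 1,
      ‖deriv (fun s' => Φ ((2 : ℝ) ^ N * s') m z) s‖ ≤ C₁ := fun s hs => by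
    simpa [iteratedDeriv_one] using hΦbound 1 le_rfl N s hs m hm z
  have hAM : ∀ s ∈ Set.Icc (1 / 4 : ℝ) 1, ‖A s‖ ≤ M := fun s hs => by
    calc ‖A s‖ = |s ^ h * φ₀ s| * ‖Φ ((2 : ℝ) ^ N * s) m z‖ := by
          simp only [hA, norm_mul, Complex.norm_real, Real.norm_eq_abs, abs_mul]
      _ ≤ K * C₁ := mul_le_mul (ha s hs).2.1 (hΦ0 s hs) (norm_nonneg _) hK.le
      _ ≤ M := by rw [hM]; nlinarith [mul_pos hK hC₁]
  have hexp : ∀ s, ‖Complex.exp (Complex.I * (g s : ℂ))‖ = 1 := fun s => by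
    rw [mul_comm]; exact Complex.norm_exp_ofReal_mul_I _
  set J : ℝ := 1 + |m| with hJ
  have hJ1 : 1 ≤ J := by rw [hJ]; linarith [abs_nonneg m]
  have hR : √l + |m| ≤ L * J := by
    have h1 : √l = (2 : ℝ) ^ (2 * N) := by
      rw [hl, show 4 * N = 2 * N + 2 * N by ring, zpow_add₀ two_ne_zero]
      exact Real.sqrt_mul_self (by positivity)
    have h2 : (2 : ℝ) ^ (2 * N) ≤ (2 : ℝ) ^ (2 * N') :=
      zpow_le_zpow_right₀ one_le_two (by linarith)
    rw [h1]
    nlinarith [abs_nonneg m]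
  have hsJ : 1 ≤ √J := Real.one_le_sqrt.2 hJ1
  have hx : 0 < |t| * l := by positivity
  have htriv : ‖∫ s in (1 / 4 : ℝ)..1, Complex.exp (Complex.I * (g s : ℂ)) * A s‖
      ≤ M * D * √J := by
    have h1 := intervalIntegral.norm_integral_le_of_norm_le_const (a := (1 / 4 : ℝ)) (b := 1)
      (C := M) (f := fun s => Complex.exp (Complex.I * (g s : ℂ)) * A s) fun s hs => by
        rw [Set.uIoc_of_le (by norm_num)] at hs
        rw [norm_mul, hexp, one_mul]
        exact hAM s (Set.Ioc_subset_Icc_self hs)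
    have h2 : |(1 : ℝ) - 1 / 4| ≤ 1 := by rw [abs_le]; norm_num
    calc _ ≤ M * |(1 : ℝ) - 1 / 4| := h1
      _ ≤ M * 1 := by gcongr
      _ ≤ M * (D * √J) := by gcongr; exact one_le_mul_of_one_le_of_one_le hD1 hsJ
      _ = _ := by ring
  have hdecay : ‖∫ s in (1 / 4 : ℝ)..1, Complex.exp (Complex.I * (g s : ℂ)) * A s‖
      ≤ M * D * √J / √(|t| * l) := by
    have hpos : ∀ s ∈ Set.Icc (1 / 4 : ℝ) 1, 0 < s := fun s hs => by linarith [hs.1]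
    refine (norm_integral_exp_mul_le_of_le_deriv_deriv (by norm_num)
      (μ := |t| * (l / (8 * (L * J)))) (σ := -SignType.sign t)
      (fun s hs => ((hasDerivAt_sqrt_quartic hl0 (hpos s hs)).const_mul (-t)).add
        ((hasDerivAt_id s).const_mul (ε * (2 : ℝ) ^ N * Ψ z)))
      (fun s hs => ((hasDerivAt_deriv_sqrt_quartic hl0 (hpos s hs)).const_mul (-t)).add_const _)
      (fun s hs => (ha s hs).1.ofReal_comp.mul (hΦd s))
      (by simp [hφ0]) (by simp [hφ0]) hAM (fun s hs => ?_) (by positivity) ?_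
      (fun s hs => ?_)).trans_eq ?_
    · refine (norm_add_le _ _).trans ?_
      simp only [norm_mul, Complex.norm_real, Real.norm_eq_abs]
      calc _ ≤ K * C₁ + K * C₁ := by
            have h1 := (ha s hs).2.1
            have h2 := (ha s hs).2.2
            have h3 := hΦ0 s hs
            have h4 := hΦ1 s hs
            rw [abs_mul] at h1
            gcongr
        _ = M := by rw [hM]; ring
    · rcases ht.lt_or_gt with h' | h' <;> simp [h']
    · rw [← mul_assoc (-_ : ℝ), neg_mul_neg, sign_mul_self]
      exact mul_le_mul_of_nonneg_left (le_deriv_deriv_sqrt_quartic hl0 hs hR) (abs_nonneg t)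
    · rw [show |t| * (l / (8 * (L * J))) = |t| * l / (8 * L * J) by ring,
        Real.sqrt_div hx.le, Real.sqrt_mul (by positivity), hD]
      field_simp
      exact Real.sqrt_mul (by positivity) _
  refine (le_mul_one_add_rpow_neg_half hx (by positivity) htriv hdecay).trans_eq ?_
  rw [← Real.sqrt_eq_rpow J]
  ring
end

section
/- There exists C > 0 such that for all t ≠ 0 and all f ∈ 𝒮(ℝ): sup_{x ∈ ℝ} |(2π)^{−1} ∫_ℝ e^{ixξ} cos(tξ²) f̂(ξ) dξ| ≤ C |t|^{−1/2} ‖f‖_{L¹(ℝ)}. In other words, the one-dimensional operator cos(tΔ) satisfies ‖cos(tΔ)‖_{L¹→L^∞} ≲ |t|^{−1/2}. -/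
open MeasureTheory

open Filter Topology

theorem integrable_fourier_exp_I (f : SchwartzMap ℝ ℂ) :
    Integrable fun ξ : ℝ => ∫ y : ℝ, Complex.exp (-(Complex.I * ((y * ξ : ℝ) : ℂ))) * f y := by
  have h := (FourierTransform.fourier f : SchwartzMap ℝ ℂ).integrable (μ := volume)
  have h2 := h.comp_div (R := 2 * Real.pi) (by positivity)
  convert h2 using 2 with ξ
  rw [SchwartzMap.fourier_coe, Real.fourier_real_eq_integral_exp_smul]
  congr 1 with y
  rw [smul_eq_mul]
  congr 2
  have : (Real.pi : ℂ) ≠ 0 := by exact_mod_cast Real.pi_ne_zero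
  push_cast
  field_simp

theorem norm_fourier_gaussian_le {b : ℂ} (hb : 0 < b.re) (u : ℝ) :
    ‖∫ ξ : ℝ, Complex.exp (Complex.I * u * ξ) * Complex.exp (-b * ξ ^ 2)‖
      ≤ (Real.pi / ‖b‖) ^ (1 / 2 : ℝ) := by
  rw [fourierIntegral_gaussian hb, norm_mul]
  have h1 : ‖((Real.pi : ℂ) / b) ^ (1 / 2 : ℂ)‖ = (Real.pi / ‖b‖) ^ (1 / 2 : ℝ) := by
    have := Complex.norm_cpow_real ((Real.pi : ℂ) / b) (1 / 2)
    push_cast at this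
    rw [this, norm_div, Complex.norm_real, Real.norm_of_nonneg Real.pi_pos.le]
  rw [h1]
  refine mul_le_of_le_one_right (by positivity) ?_
  rw [Complex.norm_exp, Real.exp_le_one_iff]
  have h2 : -(u : ℂ) ^ 2 / (4 * b) = ((-(u ^ 2 / 4) : ℝ) : ℂ) * b⁻¹ := by
    push_cast
    rw [div_eq_mul_inv, mul_inv]
    ring
  rw [h2, Complex.re_ofReal_mul, Complex.inv_re]
  have : 0 ≤ b.re / Complex.normSq b := div_nonneg hb.le (Complex.normSq_nonneg b)
  nlinarith [sq_nonneg u]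

theorem norm_integral_gaussian_mul_fourier_le {b : ℂ} (hb : 0 < b.re)
    {f : ℝ → ℂ} (hf : Integrable f) (x : ℝ) :
    ‖∫ ξ : ℝ, Complex.exp (Complex.I * ((x * ξ : ℝ) : ℂ)) * Complex.exp (-b * ξ ^ 2)
        * (∫ y : ℝ, Complex.exp (-(Complex.I * ((y * ξ : ℝ) : ℂ))) * f y)‖
      ≤ (Real.pi / ‖b‖) ^ (1 / 2 : ℝ) * ∫ y : ℝ, ‖f y‖ := by
  have hint : Integrable (Function.uncurry fun ξ y : ℝ =>
      Complex.exp (Complex.I * ((x - y : ℝ) : ℂ) * ξ) * (Complex.exp (-b * ξ ^ 2) * f y))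
      (volume.prod volume) := by
    refine ((integrable_cexp_neg_mul_sq hb).mul_prod hf).bdd_mul (c := 1)
      (Continuous.aestronglyMeasurable (by fun_prop)) (Eventually.of_forall fun p => ?_)
    rw [show Complex.I * ((x - p.2 : ℝ) : ℂ) * p.1 = (((x - p.2) * p.1 : ℝ) : ℂ) * Complex.I by
      push_cast; ring, Complex.norm_exp_ofReal_mul_I]
  calc _ = ‖∫ ξ : ℝ, ∫ y : ℝ, Complex.exp (Complex.I * ((x - y : ℝ) : ℂ) * ξ)
            * (Complex.exp (-b * ξ ^ 2) * f y)‖ := by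
        congr 2 with ξ
        rw [← integral_const_mul]
        congr 1 with y
        rw [show Complex.I * ((x - y : ℝ) : ℂ) * ξ = Complex.I * ((x * ξ : ℝ) : ℂ)
          + -(Complex.I * ((y * ξ : ℝ) : ℂ)) by push_cast; ring, Complex.exp_add]
        ring
    _ = ‖∫ y : ℝ, (∫ ξ : ℝ, Complex.exp (Complex.I * ((x - y : ℝ) : ℂ) * ξ)
            * Complex.exp (-b * ξ ^ 2)) * f y‖ := by
        rw [integral_integral_swap hint]
        congr 2 with y
        rw [← integral_mul_const]
        simp only [mul_assoc]
    _ ≤ ∫ y : ℝ, (Real.pi / ‖b‖) ^ (1 / 2 : ℝ) * ‖f y‖ := by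
        refine norm_integral_le_of_norm_le (hf.norm.const_mul _) (Eventually.of_forall fun y => ?_)
        rw [norm_mul]
        gcongr
        exact norm_fourier_gaussian_le hb _
    _ = _ := integral_const_mul _ _

theorem integrable_exp_I_quadratic_mul (x s : ℝ) {F : ℝ → ℂ} (hF : Integrable F) :
    Integrable fun ξ : ℝ => Complex.exp (Complex.I * ((x * ξ : ℝ) : ℂ))
        * Complex.exp (Complex.I * s * ξ ^ 2) * F ξ := by
  refine hF.bdd_mul (c := 1)
    (Continuous.aestronglyMeasurable (by fun_prop)) (Eventually.of_forall fun ξ => ?_)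
  rw [← Complex.exp_add, show Complex.I * ((x * ξ : ℝ) : ℂ) + Complex.I * s * ξ ^ 2
    = ((x * ξ + s * ξ ^ 2 : ℝ) : ℂ) * Complex.I by push_cast; ring, Complex.norm_exp_ofReal_mul_I]

/-- The dispersive estimate for the Schrödinger propagator with symbol `exp (i s ξ²)`. -/
theorem norm_integral_exp_I_quadratic_mul_fourier_le {s : ℝ} (hs : s ≠ 0)
    (f : SchwartzMap ℝ ℂ) (x : ℝ) :
    ‖∫ ξ : ℝ, Complex.exp (Complex.I * ((x * ξ : ℝ) : ℂ)) * Complex.exp (Complex.I * s * ξ ^ 2)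
        * (∫ y : ℝ, Complex.exp (-(Complex.I * ((y * ξ : ℝ) : ℂ))) * f y)‖
      ≤ (Real.pi / |s|) ^ (1 / 2 : ℝ) * ∫ y : ℝ, ‖f y‖ := by
  have hF := integrable_fourier_exp_I f
  set F : ℝ → ℂ := fun ξ => ∫ y : ℝ, Complex.exp (-(Complex.I * ((y * ξ : ℝ) : ℂ))) * f y
  let b : ℝ → ℂ := fun ε => ε - Complex.I * s
  have hre (ε : ℝ) : (b ε).re = ε := by simp [b]
  have hlim : Tendsto (fun ε : ℝ => ∫ ξ : ℝ, Complex.exp (Complex.I * ((x * ξ : ℝ) : ℂ))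
      * Complex.exp (-b ε * ξ ^ 2) * F ξ) (𝓝[>] 0)
      (𝓝 (∫ ξ : ℝ, Complex.exp (Complex.I * ((x * ξ : ℝ) : ℂ))
        * Complex.exp (Complex.I * s * ξ ^ 2) * F ξ)) := by
    refine tendsto_integral_filter_of_dominated_convergence (fun ξ => ‖F ξ‖) ?_ ?_ hF.norm ?_
    · exact Eventually.of_forall fun ε =>
        (Continuous.aestronglyMeasurable (by fun_prop)).mul hF.aestronglyMeasurable
    · filter_upwards [self_mem_nhdsWithin] with ε hε
      refine Eventually.of_forall fun ξ => ?_
      rw [norm_mul, ← Complex.exp_add, Complex.norm_exp]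
      refine mul_le_of_le_one_left (norm_nonneg _) (Real.exp_le_one_iff.2 ?_)
      have : (Complex.I * ((x * ξ : ℝ) : ℂ) + -b ε * ξ ^ 2).re = -ε * ξ ^ 2 := by
        rw [← Complex.ofReal_pow, Complex.add_re, Complex.re_mul_ofReal, Complex.re_mul_ofReal]
        simp [hre]
      rw [this]
      have : 0 < ε := hε
      nlinarith [sq_nonneg ξ]
    · refine Eventually.of_forall fun ξ => ?_
      have hc : Continuous fun ε : ℝ => Complex.exp (Complex.I * ((x * ξ : ℝ) : ℂ))
          * Complex.exp (-b ε * ξ ^ 2) * F ξ := by fun_prop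
      have := (hc.tendsto 0).mono_left (nhdsWithin_le_nhds (s := Set.Ioi 0))
      simpa [b] using this
  refine le_of_tendsto hlim.norm ?_
  filter_upwards [self_mem_nhdsWithin] with ε hε
  refine (norm_integral_gaussian_mul_fourier_le (by rw [hre]; exact hε) f.integrable x).trans ?_
  have hbs : |s| ≤ ‖b ε‖ := by
    simpa [b] using Complex.abs_im_le_norm (b ε)
  have : 0 < |s| := abs_pos.2 hs
  gcongr

/-- Free dispersive estimate (Proposition 2.3 (ii)):
`‖cos(tΔ)‖_{L¹→L^∞} ≲ |t|^{-1/2}` in one dimension, written via the Fourier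
multiplier with symbol `cos(tξ²)`. -/
theorem stmt_7 :
    ∃ C > 0, ∀ t : ℝ, t ≠ 0 → ∀ f : SchwartzMap ℝ ℂ, ∀ x : ℝ,
      ‖(2 * Real.pi)⁻¹ • ∫ ξ : ℝ,
          Complex.exp (Complex.I * ((x * ξ : ℝ) : ℂ))
          * ((Real.cos (t * ξ^2) : ℝ) : ℂ)
          * (∫ y : ℝ, Complex.exp (-(Complex.I * ((y * ξ : ℝ) : ℂ))) * f y)‖
      ≤ C * |t| ^ (-(1/2) : ℝ) * ∫ y : ℝ, ‖f y‖ := by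
  refine ⟨(2 * Real.pi)⁻¹ * Real.pi ^ (1 / 2 : ℝ), by positivity, fun t ht f x => ?_⟩
  have hF := integrable_fourier_exp_I f
  have hp := norm_integral_exp_I_quadratic_mul_fourier_le ht f x
  have hm := norm_integral_exp_I_quadratic_mul_fourier_le (neg_ne_zero.2 ht) f x
  have ip := integrable_exp_I_quadratic_mul x t hF
  have im := integrable_exp_I_quadratic_mul x (-t) hF
  rw [abs_neg] at hm
  rw [Real.div_rpow Real.pi_pos.le (abs_nonneg t), div_eq_mul_inv,
    ← Real.rpow_neg (abs_nonneg t)] at hp hm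
  rw [norm_smul, Real.norm_of_nonneg (by positivity), mul_assoc, mul_assoc]
  refine mul_le_mul_of_nonneg_left ?_ (by positivity)
  have hcos : (∫ ξ : ℝ, Complex.exp (Complex.I * ((x * ξ : ℝ) : ℂ))
      * ((Real.cos (t * ξ^2) : ℝ) : ℂ)
      * (∫ y : ℝ, Complex.exp (-(Complex.I * ((y * ξ : ℝ) : ℂ))) * f y))
      = (1 / 2 : ℂ) * ((∫ ξ : ℝ, Complex.exp (Complex.I * ((x * ξ : ℝ) : ℂ))
          * Complex.exp (Complex.I * t * ξ ^ 2)
          * (∫ y : ℝ, Complex.exp (-(Complex.I * ((y * ξ : ℝ) : ℂ))) * f y))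
        + ∫ ξ : ℝ, Complex.exp (Complex.I * ((x * ξ : ℝ) : ℂ))
          * Complex.exp (Complex.I * (-t : ℝ) * ξ ^ 2)
          * (∫ y : ℝ, Complex.exp (-(Complex.I * ((y * ξ : ℝ) : ℂ))) * f y)) := by
    rw [← integral_add ip im, ← integral_const_mul]
    congr 1 with ξ
    rw [Complex.ofReal_cos, Complex.cos,
      show ((t * ξ ^ 2 : ℝ) : ℂ) * Complex.I = Complex.I * t * ξ ^ 2 by push_cast; ring,
      show -((t * ξ ^ 2 : ℝ) : ℂ) * Complex.I = Complex.I * (-t : ℝ) * ξ ^ 2 by push_cast; ring]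
    ring
  rw [hcos, norm_mul]
  refine (mul_le_mul_of_nonneg_left (norm_add_le _ _) (norm_nonneg _)).trans ?_
  norm_num at hp hm ⊢
  linarith
end
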